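/- Let ℓ ≥ 24 and let τ, κ ≥ 0 be integers. Then there exist integers m, c ≥ 0 with the following property. Let G be a graph such that ω(G) ≤ κ, every induced subgraph H of G with ω(H) < κ has χ(H) ≤ τ, and G admits a stably ℓ-crested stable multicover (N_x : x ∈ X) of a set C with |X| = m and χ(C) > c. Then G has a hole of length exactly ℓ. -/

import Mathlib

open SimpleGraph

variable {V : Type*}

/-- `B` covers `C`: they are disjoint and every vertex of `C` has a neighbour in `B`. -/
def Covers (G : SimpleGraph V) (B C : Set V) : Prop :=
  Disjoint B C ∧ ∀ v ∈ C, ∃ b ∈ B, G.Adj b v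

/-- `(x, N)` is a cover of `C`. -/
def IsCover (G : SimpleGraph V) (x : V) (N C : Set V) : Prop :=
  (∀ u ∈ N, G.Adj x u) ∧ x ∉ C ∧ (∀ u ∈ C, ¬ G.Adj x u) ∧ Covers G N C

/-- `S` is a stable set of `G`. -/
def StableSet (G : SimpleGraph V) (S : Set V) : Prop :=
  ∀ u ∈ S, ∀ v ∈ S, ¬ G.Adj u v

/-- `(N x : x ∈ X)` is a multicover of `C` in `G`. -/
def IsMulticover (G : SimpleGraph V) (X : Finset V) (N : V → Set V) (C : Set V) : Prop :=
  StableSet G ↑X ∧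
  (∀ x ∈ X, IsCover G x (N x) C) ∧
  (∀ x ∈ X, ∀ y ∈ X, x ≠ y → y ∉ N x ∧ ∀ u ∈ N x, ¬ G.Adj y u)

/-- A multicover is stable if each of the sets `N x` is stable. -/
def IsStableMulticover (G : SimpleGraph V) (X : Finset V) (N : V → Set V) (C : Set V) : Prop :=
  IsMulticover G X N C ∧ ∀ x ∈ X, StableSet G (N x)

/-- The multicover `(N x : x ∈ X)` of `C` is stably `k`-crested, as witnessed by
the vertices `a i` (`i : Fin k`) and `b i x` (`i : Fin k`, `x ∈ X`). -/
def StablyCrested (G : SimpleGraph V) (X : Finset V) (N : V → Set V) (C : Set V)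
    (k : ℕ) (a : Fin k → V) (b : Fin k → V → V) : Prop :=
  let U : Set V := (↑X : Set V) ∪ (⋃ x ∈ X, N x) ∪ C
  Function.Injective a ∧
  (∀ i i' : Fin k, ∀ x ∈ X, a i' ≠ b i x) ∧
  (∀ i i' : Fin k, ∀ x ∈ X, ∀ x' ∈ X, (i ≠ i' ∨ x ≠ x') → b i x ≠ b i' x') ∧
  (∀ i, a i ∉ U) ∧ (∀ i : Fin k, ∀ x ∈ X, b i x ∉ U) ∧
  (∀ i : Fin k, ∀ x ∈ X, G.Adj (b i x) x) ∧
  (∀ i, ∀ u ∈ U, ¬ G.Adj (a i) u) ∧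
  (∀ i : Fin k, ∀ x ∈ X, ∀ u ∈ U, G.Adj (b i x) u → u = x) ∧
  (∀ i : Fin k, ∀ x ∈ X, G.Adj (a i) (b i x)) ∧
  (∀ i i' : Fin k, ∀ x ∈ X, G.Adj (a i') (b i x) → i = i') ∧
  (∀ i i' : Fin k, ¬ G.Adj (a i) (a i')) ∧
  (∀ i i' : Fin k, ∀ x ∈ X, ∀ y ∈ X, x ≠ y → ¬ G.Adj (b i x) (b i' y))

section Colorings

lemma SimpleGraph.Colorable.induce_mono {G : SimpleGraph V} {S T : Set V} {n : ℕ}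
    (hT : (G.induce T).Colorable n) (h : S ⊆ T) : (G.induce S).Colorable n :=
  hT.of_hom (G.induceHomOfLE h).toHom

lemma SimpleGraph.Colorable.induce_union {G : SimpleGraph V} {S T : Set V} {p q : ℕ}
    (hS : (G.induce S).Colorable p) (hT : (G.induce T).Colorable q) :
    (G.induce (S ∪ T)).Colorable (p + q) := by
  classical
  obtain ⟨f⟩ := hS
  obtain ⟨g⟩ := hT
  have hmem (v : ↥(S ∪ T)) (h : v.1 ∉ S) : v.1 ∈ T := v.2.resolve_left h
  let F : (G.induce (S ∪ T)).Coloring (Fin p ⊕ Fin q) := Coloring.mk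
    (fun v => if h : v.1 ∈ S then Sum.inl (f ⟨v.1, h⟩) else Sum.inr (g ⟨v.1, hmem v h⟩)) (by
      intro u v huv
      by_cases hu : u.1 ∈ S <;> by_cases hv : v.1 ∈ S
      · simp only [hu, hv, dite_true, ne_eq, Sum.inl.injEq]
        exact f.valid (v := ⟨u.1, hu⟩) (w := ⟨v.1, hv⟩) huv
      · simp [hu, hv]
      · simp [hu, hv]
      · simp only [hu, hv, dite_false, ne_eq, Sum.inr.injEq]
        exact g.valid (v := ⟨u.1, hmem u hu⟩) (w := ⟨v.1, hmem v hv⟩) huv)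
  simpa using F.colorable

lemma not_colorable_induce_diff {G : SimpleGraph V} {S T : Set V} {p q : ℕ}
    (hS : ¬ (G.induce S).Colorable (p + q)) (hT : (G.induce (S ∩ T)).Colorable q) :
    ¬ (G.induce (S \ T)).Colorable p := fun h =>
  hS ((h.induce_union hT).induce_mono (by rw [Set.sdiff_union_inter]))

lemma nonempty_of_not_colorable {G : SimpleGraph V} {S : Set V} {n : ℕ}
    (h : ¬ (G.induce S).Colorable n) : S.Nonempty := by
  by_contra hS
  have : IsEmpty S := Set.isEmpty_coe_sort.2 (Set.not_nonempty_iff_eq_empty.1 hS)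
  exact h (.of_isEmpty n)

lemma colorable_induce_biUnion {G : SimpleGraph V} {n : ℕ} (F : Finset V) (S : V → Set V)
    (h : ∀ v ∈ F, (G.induce (S v)).Colorable n) :
    (G.induce (⋃ v ∈ F, S v)).Colorable (F.card * n) := by
  classical
  induction F using Finset.induction_on with
  | empty => simp
  | insert a F ha ih =>
    rw [Finset.card_insert_of_notMem ha, Finset.set_biUnion_insert, add_mul, one_mul, add_comm]
    exact (h a (by simp)).induce_union (ih fun v hv => h v (by simp [hv]))

end Colorings

/-- The clique number of `G` is at most `κ`, and every set of vertices containing no clique of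
size `κ` is `τ`-colourable. -/
structure CliqueControlled (G : SimpleGraph V) (τ κ : ℕ) : Prop where
  cliqueFree : G.CliqueFree (κ + 1)
  colorable : ∀ Y : Set V, G.CliqueFreeOn Y κ → (G.induce Y).Colorable τ

namespace CliqueControlled

variable {G : SimpleGraph V} {τ κ : ℕ}

lemma colorable_neighborSet (hG : CliqueControlled G τ κ) (v : V) :
    (G.induce (G.neighborSet v)).Colorable τ := by
  classical
  refine hG.colorable _ fun s hs hc => hG.cliqueFree _ (hc.insert (a := v) fun b hb => hs hb)

lemma exists_isNClique (hG : CliqueControlled G τ κ) {Y : Set V}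
    (hY : ¬ (G.induce Y).Colorable τ) : ∃ K : Finset V, ↑K ⊆ Y ∧ G.IsNClique κ K := by
  by_contra! h
  exact hY (hG.colorable Y fun s hs => h s hs)

end CliqueControlled

section Covering

variable {G : SimpleGraph V}

/-- Two sets are disjoint with no edges between them. -/
def Anticomplete (G : SimpleGraph V) (S T : Set V) : Prop :=
  ∀ u ∈ S, ∀ v ∈ T, u ≠ v ∧ ¬ G.Adj u v

/-- Among the subsets of a cover, one covers a part of `D` whose chromatic number exceeds `d` by at
most `τ`. -/
lemma exists_subset_covering {τ d : ℕ} (hτ : ∀ v, (G.induce (G.neighborSet v)).Colorable τ)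
    (D : Set V) (N : Finset V)
    (hN : ¬ (G.induce (D ∩ ⋃ v ∈ N, G.neighborSet v)).Colorable d) :
    ∃ M ⊆ N, ¬ (G.induce (D ∩ ⋃ v ∈ M, G.neighborSet v)).Colorable d ∧
      (G.induce (D ∩ ⋃ v ∈ M, G.neighborSet v)).Colorable (d + τ) := by
  classical
  induction N using Finset.induction_on with
  | empty =>
    exact absurd (nonempty_of_not_colorable hN) (by simp)
  | insert a N ha ih =>
    by_cases h : (G.induce (D ∩ ⋃ v ∈ N, G.neighborSet v)).Colorable d
    · refine ⟨insert a N, subset_rfl, hN, (h.induce_union (hτ a)).induce_mono ?_⟩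
      rw [Finset.set_biUnion_insert, Set.inter_union_distrib_left, Set.union_comm]
      exact Set.union_subset_union_right _ Set.inter_subset_right
    · obtain ⟨M, hM, h⟩ := ih h
      exact ⟨M, hM.trans (Finset.subset_insert _ _), h⟩

lemma exists_split_one [Finite V] {τ d : ℕ}
    (hτ : ∀ v, (G.induce (G.neighborSet v)).Colorable τ) {N D E : Set V}
    (hND : ∀ v ∈ D, ∃ u ∈ N, G.Adj u v)
    (hD : ¬ (G.induce D).Colorable (2 * d + τ)) (hE : ¬ (G.induce E).Colorable (2 * d + τ)) :
    ∃ D' ⊆ D, ∃ E' ⊆ E, ¬ (G.induce D').Colorable d ∧ ¬ (G.induce E').Colorable d ∧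
      ∃ M ⊆ N, ((∀ v ∈ D', ∃ u ∈ M, G.Adj u v) ∧ ∀ u ∈ M, ∀ v ∈ E', ¬ G.Adj u v) ∨
        ((∀ v ∈ E', ∃ u ∈ M, G.Adj u v) ∧ ∀ u ∈ M, ∀ v ∈ D', ¬ G.Adj u v) := by
  have hfin := N.toFinite
  have hcov : D ∩ ⋃ v ∈ hfin.toFinset, G.neighborSet v = D := by
    rw [Set.inter_eq_left]
    intro v hv
    simpa using hND v hv
  obtain ⟨M, hMN, h1, h2⟩ := exists_subset_covering (d := d) hτ D hfin.toFinset (by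
    rw [hcov]
    exact fun h => hD (h.mono (by lia)))
  set Z := ⋃ v ∈ M, G.neighborSet v with hZ
  have memZ (v : V) : v ∈ Z ↔ ∃ u ∈ M, G.Adj u v := by simp [hZ]
  have hMN' : (M : Set V) ⊆ N := fun u hu => by simpa using hMN hu
  by_cases hEZ : (G.induce (E ∩ Z)).Colorable d
  · refine ⟨D ∩ Z, Set.inter_subset_left, E \ Z, Set.sdiff_subset, h1, ?_, M, hMN', .inl ⟨?_, ?_⟩⟩
    · exact not_colorable_induce_diff (fun h => hE (h.mono (by lia))) hEZ
    · exact fun v hv => (memZ v).1 hv.2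
    · exact fun u hu v hv h => hv.2 ((memZ v).2 ⟨u, hu, h⟩)
  · refine ⟨D \ Z, Set.sdiff_subset, E ∩ Z, Set.inter_subset_left, ?_, hEZ, M, hMN', .inr ⟨?_, ?_⟩⟩
    · exact not_colorable_induce_diff (fun h => hD (h.mono (by lia))) h2
    · exact fun v hv => (memZ v).1 hv.2
    · exact fun u hu v hv h => hv.2 ((memZ v).2 ⟨u, hu, h⟩)

lemma exists_split (τ n d : ℕ) : ∃ d₀ : ℕ, ∀ (V : Type) [Finite V] (G : SimpleGraph V)
    (X : Finset V) (N : V → Set V) (D E : Set V),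
    (∀ v, (G.induce (G.neighborSet v)).Colorable τ) → X.card = n →
    (∀ x ∈ X, ∀ v ∈ D, ∃ u ∈ N x, G.Adj u v) → (∀ x ∈ X, ∀ v ∈ E, ∃ u ∈ N x, G.Adj u v) →
    ¬ (G.induce D).Colorable d₀ → ¬ (G.induce E).Colorable d₀ →
    ∃ D' ⊆ D, ∃ E' ⊆ E, ¬ (G.induce D').Colorable d ∧ ¬ (G.induce E').Colorable d ∧
      ∃ M : V → Set V, ∀ x ∈ X, M x ⊆ N x ∧
        (((∀ v ∈ D', ∃ u ∈ M x, G.Adj u v) ∧ ∀ u ∈ M x, ∀ v ∈ E', ¬ G.Adj u v) ∨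
        ((∀ v ∈ E', ∃ u ∈ M x, G.Adj u v) ∧ ∀ u ∈ M x, ∀ v ∈ D', ¬ G.Adj u v)) := by
  classical
  induction n with
  | zero =>
    refine ⟨d, fun V _ G X N D E _ hX _ _ hD hE => ⟨D, subset_rfl, E, subset_rfl, hD, hE, N, ?_⟩⟩
    simp [Finset.card_eq_zero.1 hX]
  | succ n ih =>
    obtain ⟨d₁, ih⟩ := ih
    refine ⟨2 * d₁ + τ, fun V _ G X N D E hτ hX hND hNE hD hE => ?_⟩
    obtain ⟨x, Y, hxY, rfl, hY⟩ := Finset.card_eq_succ.1 hX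
    obtain ⟨D₁, hD₁, E₁, hE₁, hcD, hcE, L, hL, hLc⟩ :=
      exists_split_one hτ (hND x (by simp)) hD hE
    obtain ⟨D₂, hD₂, E₂, hE₂, hcD₂, hcE₂, M, hM⟩ := ih V G Y N D₁ E₁ hτ hY
      (fun y hy v hv => hND y (by simp [hy]) v (hD₁ hv))
      (fun y hy v hv => hNE y (by simp [hy]) v (hE₁ hv)) hcD hcE
    refine ⟨D₂, hD₂.trans hD₁, E₂, hE₂.trans hE₁, hcD₂, hcE₂, Function.update M x L, ?_⟩
    intro y hy
    rcases Finset.mem_insert.1 hy with rfl | hy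
    · rw [Function.update_self]
      refine ⟨hL, hLc.imp ?_ ?_⟩
      · exact fun h => ⟨fun v hv => h.1 v (hD₂ hv), fun u hu v hv => h.2 u hu v (hE₂ hv)⟩
      · exact fun h => ⟨fun v hv => h.1 v (hE₂ hv), fun u hu v hv => h.2 u hu v (hD₂ hv)⟩
    · rw [Function.update_of_ne (ne_of_mem_of_not_mem hy hxY)]
      exact hM y hy

/-- Passing to a subset of `X`, there are two parts `D`, `E` of large chromatic number such that
`E` is covered by subsets of the sets `N x` having no edges to `D`. -/
lemma exists_split_uniform (τ n d : ℕ) : ∃ m d₀ : ℕ, ∀ (V : Type) [Finite V] (G : SimpleGraph V)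
    (X : Finset V) (N : V → Set V) (C : Set V),
    (∀ v, (G.induce (G.neighborSet v)).Colorable τ) → m ≤ X.card →
    (∀ x ∈ X, ∀ v ∈ C, ∃ u ∈ N x, G.Adj u v) → ¬ (G.induce C).Colorable d₀ →
    ∃ X' ⊆ X, X'.card = n ∧ ∃ D ⊆ C, ∃ E ⊆ C,
      ¬ (G.induce D).Colorable d ∧ ¬ (G.induce E).Colorable d ∧
      ∃ M : V → Set V, ∀ x ∈ X', M x ⊆ N x ∧
        (∀ v ∈ E, ∃ u ∈ M x, G.Adj u v) ∧ ∀ u ∈ M x, ∀ v ∈ D, ¬ G.Adj u v := by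
  classical
  obtain ⟨d₀, h⟩ := exists_split τ (2 * n) d
  refine ⟨2 * n, d₀, fun V _ G X N C hτ hX hN hC => ?_⟩
  obtain ⟨Y, hYX, hY⟩ := Finset.exists_subset_card_eq hX
  have hN' : ∀ x ∈ Y, ∀ v ∈ C, ∃ u ∈ N x, G.Adj u v := fun x hx => hN x (hYX hx)
  obtain ⟨D, hD, E, hE, hcD, hcE, M, hM⟩ := h V G Y N C C hτ hY hN' hN' hC hC
  set P : V → Prop := fun x => (∀ v ∈ D, ∃ u ∈ M x, G.Adj u v) ∧ ∀ u ∈ M x, ∀ v ∈ E, ¬ G.Adj u v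
  have hcard := Finset.card_filter_add_card_filter_not (s := Y) P
  rcases le_total n (Y.filter P).card with hn | hn
  · obtain ⟨Z, hZ, hZn⟩ := Finset.exists_subset_card_eq hn
    refine ⟨Z, (hZ.trans (Finset.filter_subset _ _)).trans hYX, hZn, E, hE, D, hD, hcE, hcD, M, ?_⟩
    intro x hx
    have := Finset.mem_filter.1 (hZ hx)
    exact ⟨(hM x this.1).1, this.2⟩
  · obtain ⟨Z, hZ, hZn⟩ := Finset.exists_subset_card_eq
      (show n ≤ (Y.filter fun x => ¬ P x).card by lia)
    refine ⟨Z, (hZ.trans (Finset.filter_subset _ _)).trans hYX, hZn, D, hD, E, hE, hcD, hcE, M, ?_⟩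
    intro x hx
    have := Finset.mem_filter.1 (hZ hx)
    exact ⟨(hM x this.1).1, (hM x this.1).2.resolve_left this.2⟩

/-- Shrinking the covering sets, every pair in `T` becomes complete or anticomplete. -/
lemma exists_purified {d : ℕ} (X : Finset V) (T : Finset (V × V)) :
    ∀ (M : V → Set V) (E : Set V), (∀ x ∈ X, ∀ v ∈ E, ∃ u ∈ M x, G.Adj u v) →
    ¬ (G.induce E).Colorable (2 ^ T.card * d) →
    ∃ E' ⊆ E, ¬ (G.induce E').Colorable d ∧ ∃ M' : V → Set V,
      (∀ x, M' x ⊆ M x) ∧ (∀ x ∈ X, ∀ v ∈ E', ∃ u ∈ M' x, G.Adj u v) ∧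
      ∀ p ∈ T, (∀ u ∈ M' p.2, G.Adj p.1 u) ∨ (∀ u ∈ M' p.2, ¬ G.Adj p.1 u) := by
  classical
  induction T using Finset.induction_on with
  | empty =>
    intro M E hM hE
    exact ⟨E, subset_rfl, by simpa using hE, M, fun _ => subset_rfl, hM, by simp⟩
  | insert p T hp ih =>
    intro M E hM hE
    rw [Finset.card_insert_of_notMem hp, pow_succ, mul_comm (2 ^ _), mul_assoc, two_mul] at hE
    set Z : Set V := {v | ∃ u ∈ M p.2, G.Adj p.1 u ∧ G.Adj u v}
    suffices h : ∃ E₁ ⊆ E, ¬ (G.induce E₁).Colorable (2 ^ T.card * d) ∧ ∃ L ⊆ M p.2,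
        (∀ v ∈ E₁, ∃ u ∈ L, G.Adj u v) ∧
        ((∀ u ∈ L, G.Adj p.1 u) ∨ (∀ u ∈ L, ¬ G.Adj p.1 u)) ∨ p.2 ∉ X ∧ L = ∅ by
      obtain ⟨E₁, hE₁, hcE₁, L, hL, hL'⟩ := h
      obtain ⟨E₂, hE₂, hcE₂, M', hM', hM'c, hT⟩ := ih (Function.update M p.2 L) E₁ (by
        intro x hx v hv
        by_cases hxp : x = p.2
        · subst hxp
          rw [Function.update_self]
          rcases hL' with h | h
          · exact h.1 v hv
          · exact absurd hx h.1
        · rw [Function.update_of_ne hxp]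
          exact hM x hx v (hE₁ hv)) hcE₁
      refine ⟨E₂, hE₂.trans hE₁, hcE₂, M', fun x => (hM' x).trans ?_, hM'c, ?_⟩
      · by_cases hxp : x = p.2
        · subst hxp
          rwa [Function.update_self]
        · rw [Function.update_of_ne hxp]
      · intro q hq
        rcases Finset.mem_insert.1 hq with rfl | hq
        · have hsub : M' q.2 ⊆ L := by simpa using hM' q.2
          rcases hL' with h | h
          · exact h.2.imp (fun h u hu => h u (hsub hu)) (fun h u hu => h u (hsub hu))
          · exact .inl fun u hu => by simpa [h.2] using hsub hu
        · exact hT q hq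
    by_cases hpX : p.2 ∈ X
    swap
    · exact ⟨E, subset_rfl, fun h => hE (h.mono (by lia)), ∅, by simp, .inr ⟨hpX, rfl⟩⟩
    by_cases hEZ : (G.induce (E ∩ Z)).Colorable (2 ^ T.card * d)
    · refine ⟨E \ Z, Set.sdiff_subset, not_colorable_induce_diff hE hEZ,
        {u ∈ M p.2 | ¬ G.Adj p.1 u}, Set.sep_subset _ _, .inl ⟨?_, .inr fun u hu => hu.2⟩⟩
      intro v hv
      obtain ⟨u, hu, huv⟩ := hM p.2 hpX v hv.1
      exact ⟨u, ⟨hu, fun h => hv.2 ⟨u, hu, h, huv⟩⟩, huv⟩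
    · refine ⟨E ∩ Z, Set.inter_subset_left, hEZ,
        {u ∈ M p.2 | G.Adj p.1 u}, Set.sep_subset _ _, .inl ⟨?_, .inl fun u hu => hu.2⟩⟩
      rintro v ⟨-, u, hu, hpu, huv⟩
      exact ⟨u, ⟨hu, hpu⟩, huv⟩

end Covering

/-- Ramsey's theorem for colourings of ordered pairs, stated for sublists. -/
lemma exists_sublist_pairwise {α : Type} [Fintype α] [Nonempty α] (t : α → ℕ) :
    ∃ R : ℕ, ∀ (V : Type) (col : V → V → α) (l : List V), R ≤ l.length →
      ∃ (c : α) (l' : List V), l'.Sublist l ∧ l'.length = t c ∧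
        l'.Pairwise fun x y => col x y = c := by
  classical
  induction h : ∑ c, t c using Nat.strong_induction_on generalizing t with
  | _ s ih =>
  by_cases h0 : ∃ c, t c = 0
  · obtain ⟨c, hc⟩ := h0
    exact ⟨0, fun V col l _ => ⟨c, [], List.nil_sublist _, by simp [hc], List.Pairwise.nil⟩⟩
  push Not at h0
  have hstep (c : α) : ∑ c', Function.update t c (t c - 1) c' < s := by
    rw [← h]
    refine Finset.sum_lt_sum (fun i _ => ?_) ⟨c, Finset.mem_univ _, ?_⟩
    · by_cases hi : i = c
      · subst hi
        simp
      · simp [hi]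
    · have := h0 c
      rw [Function.update_self]
      lia
  choose R hR using fun c => ih _ (hstep c) (Function.update t c (t c - 1)) rfl
  refine ⟨∑ c, R c + 1, fun V col l hl => ?_⟩
  match l, hl with
  | x :: l, hl =>
  have hcount : ∑ c, (l.filter fun y => col x y = c).length = l.length := by
    simp only [← List.countP_eq_length_filter]
    clear hl
    induction l with
    | nil => simp
    | cons y l ihl => simp [List.countP_cons, Finset.sum_add_distrib, ihl]
  obtain ⟨c, hc⟩ : ∃ c, R c ≤ (l.filter fun y => col x y = c).length := by
    by_contra! hlt
    have := Finset.sum_le_sum fun c (_ : c ∈ Finset.univ) => (hlt c).le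
    have hl' : ∑ c, R c ≤ l.length := by simpa using hl
    have := Finset.sum_lt_sum_of_nonempty Finset.univ_nonempty fun c _ => hlt c
    lia
  obtain ⟨c', l', hsub, hlen, hpw⟩ := hR c V col _ hc
  by_cases hcc : c' = c
  · subst hcc
    rw [Function.update_self] at hlen
    refine ⟨c', x :: l', ?_, ?_, ?_⟩
    · exact (hsub.trans List.filter_sublist).cons_cons x
    · have := h0 c'
      simp only [List.length_cons]
      lia
    · refine List.pairwise_cons.2 ⟨fun y hy => ?_, hpw⟩
      simpa using (List.mem_filter.1 (hsub.subset hy)).2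
  · rw [Function.update_of_ne hcc] at hlen
    exact ⟨c', l', (hsub.trans List.filter_sublist).cons x, hlen, hpw⟩

section InducedPaths

variable {G : SimpleGraph V}

/-- The vertices of the list are distinct and induce a path, in the given order. -/
def IsInducedPath (G : SimpleGraph V) : List V → Prop
  | [] => True
  | a :: l => (∀ b ∈ l, a ≠ b ∧ (G.Adj a b ↔ l.head? = some b)) ∧ IsInducedPath G l

lemma IsInducedPath.getElem {l : List V} (hl : IsInducedPath G l) {i j : ℕ} (hij : i < j)
    (hj : j < l.length) :
    l[i] ≠ l[j] ∧ (G.Adj l[i] l[j] ↔ j = i + 1) := by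
  induction l generalizing i j with
  | nil => simp at hj
  | cons a l ih =>
    obtain ⟨j, rfl⟩ : ∃ k, j = k + 1 := ⟨j - 1, by lia⟩
    have hj' : j < l.length := by simpa using hj
    cases i with
    | succ i => simpa using ih hl.2 (show i < j by lia) hj'
    | zero =>
      refine ⟨by simpa using (hl.1 _ (List.getElem_mem hj')).1, ?_⟩
      simp only [List.getElem_cons_zero, List.getElem_cons_succ]
      rw [(hl.1 _ (List.getElem_mem hj')).2, List.head?_eq_getElem?,
        List.getElem?_eq_getElem (by lia), Option.some_inj]
      constructor
      · intro h
        by_contra hne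
        exact (ih hl.2 (show 0 < j by lia) hj').1 h
      · intro h
        obtain rfl : j = 0 := by lia
        rfl

lemma IsInducedPath.append_cons {p q : List V} {y : V} (hp : IsInducedPath G p)
    (hq : IsInducedPath G q) (hpq : ∀ u ∈ p, ∀ v ∈ q, u ≠ v ∧ ¬ G.Adj u v)
    (hyp : ∀ v ∈ p, y ≠ v ∧ (G.Adj y v ↔ p.getLast? = some v))
    (hyq : ∀ v ∈ q, y ≠ v ∧ (G.Adj y v ↔ q.head? = some v)) :
    IsInducedPath G (p ++ y :: q) := by
  induction p with
  | nil => exact ⟨hyq, hq⟩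
  | cons a p ih =>
    refine ⟨?_, ?_⟩
    · intro b hb
      rcases List.mem_append.1 hb with hbp | hby
      · have := hp.1 b hbp
        cases p with
        | nil => simp at hbp
        | cons a' p => simpa using this
      rcases List.mem_cons.1 hby with rfl | hbq
      · refine ⟨(hyp a (by simp)).1.symm, ?_⟩
        rw [G.adj_comm, (hyp a (by simp)).2]
        cases p with
        | nil => simp
        | cons a' p =>
          have h1 : (a :: a' :: p).getLast? ≠ some a := by
            rw [List.getLast?_cons_cons]
            intro h
            exact (hp.1 a (List.mem_of_getLast? h)).1 rfl
          have h2 : a' ≠ b := (hyp a' (by simp)).1.symm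
          exact iff_of_false h1 (by simp [h2])
      · have := hpq a (by simp) b hbq
        refine ⟨this.1, iff_of_false this.2 ?_⟩
        cases p with
        | nil => simpa using (hyq b hbq).1
        | cons a' p => simpa using (hpq a' (by simp) b hbq).1
    · refine ih hp.2 (fun u hu => hpq u (by simp [hu])) fun v hv => ?_
      have := hyp v (by simp [hv])
      cases p with
      | nil => simp at hv
      | cons a' p => simpa only [List.getLast?_cons_cons] using this

/-- A vertex adjacent to exactly the two ends of an induced path closes it to an induced cycle. -/
lemma IsInducedPath.nonempty_cycleGraph_embedding {l : List V} {a : V} {n : ℕ}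
    (hl : IsInducedPath G l) (hn : l.length + 1 = n) (h2 : 2 ≤ l.length)
    (ha : ∀ v ∈ l, a ≠ v ∧ (G.Adj a v ↔ l.head? = some v ∨ l.getLast? = some v)) :
    Nonempty (cycleGraph n ↪g G) := by
  subst hn
  have key (i j : ℕ) (hij : i < j) (hj : j < (a :: l).length) :
      (a :: l)[i] ≠ (a :: l)[j] ∧
        (G.Adj (a :: l)[i] (a :: l)[j] ↔ j = i + 1 ∨ (i = 0 ∧ j = l.length)) := by
    obtain ⟨j, rfl⟩ : ∃ k, j = k + 1 := ⟨j - 1, by lia⟩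
    have hj' : j < l.length := by simpa using hj
    have inj (k : ℕ) (hk : k < l.length) : l[k] = l[j] ↔ k = j := by
      refine ⟨fun h => ?_, fun h => by subst h; rfl⟩
      rcases lt_trichotomy k j with hkj | hkj | hkj
      · exact absurd h (hl.getElem hkj hj').1
      · exact hkj
      · exact absurd h.symm (hl.getElem hkj hk).1
    cases i with
    | succ i =>
      have := hl.getElem (show i < j by lia) hj'
      simpa using this
    | zero =>
      have := ha _ (List.getElem_mem hj')
      refine ⟨this.1, ?_⟩
      simp only [List.getElem_cons_zero, List.getElem_cons_succ]
      rw [this.2, List.head?_eq_getElem?, List.getLast?_eq_getElem?,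
        List.getElem?_eq_getElem (by lia), List.getElem?_eq_getElem (by lia), Option.some_inj,
        Option.some_inj, inj, inj]
      lia
  have adj (i j : Fin (l.length + 1)) (hij : i < j) :
      (cycleGraph (l.length + 1)).Adj i j ↔ j.1 = i.1 + 1 ∨ (i.1 = 0 ∧ j.1 = l.length) := by
    have hlt : i.1 < j.1 := hij
    have hj := j.2
    rw [cycleGraph_adj', Fin.coe_sub_iff_lt.2 hij, Fin.coe_sub_iff_le.2 hij.le]
    lia
  have hb (i : Fin (l.length + 1)) : i.1 < (a :: l).length := i.2
  refine ⟨⟨⟨fun i => (a :: l)[i.1]'(hb i), fun i j h => ?_⟩, fun {i j} => ?_⟩⟩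
  · rcases lt_trichotomy i j with hij | hij | hij
    · exact absurd h (key i j hij (hb j)).1
    · exact hij
    · exact absurd h.symm (key j i hij (hb i)).1
  · change G.Adj ((a :: l)[i.1]'(hb i)) ((a :: l)[j.1]'(hb j)) ↔ _
    rcases lt_trichotomy i j with hij | hij | hij
    · rw [adj i j hij, (key i j hij (hb j)).2]
    · subst hij
      simp
    · rw [G.adj_comm, (cycleGraph _).adj_comm, adj j i hij, (key j i hij (hb i)).2]

/-- `p` is the interior of an induced path from `x` to `y` with no edges to `X \ {x, y}`. -/
structure IsLink (G : SimpleGraph V) (X : Finset V) (x y : V) (p : List V) : Prop where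
  path : IsInducedPath G p
  two_le_length : 2 ≤ p.length
  adj_iff : ∀ z ∈ X, ∀ v ∈ p,
    z ≠ v ∧ (G.Adj z v ↔ (z = x ∧ p.head? = some v) ∨ (z = y ∧ p.getLast? = some v))

/-- Any two vertices of `X` can be joined by induced paths of lengths `4` and `e` with interior
in `W`. -/
def IsConnector (G : SimpleGraph V) (e : ℕ) (X : Finset V) (W : Set V) : Prop :=
  ∀ x ∈ X, ∀ y ∈ X, x ≠ y → ∀ k, k = 4 ∨ k = e →
    ∃ p : List V, IsLink G X x y p ∧ p.length + 1 = k ∧ ∀ v ∈ p, v ∈ W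

lemma exists_chain {e : ℕ} {X : Finset V} (hX : StableSet G ↑X) (L : List (Set V)) :
    ∀ (ks : List ℕ), L ≠ [] → ks.length = L.length → (∀ k ∈ ks, k = 4 ∨ k = e) →
    (∀ W ∈ L, IsConnector G e X W) → L.Pairwise (Anticomplete G) →
    ∀ x ∈ X, ∀ y ∈ X, x ≠ y → ∀ Y ⊆ X, x ∉ Y → y ∉ Y → L.length ≤ Y.card + 1 →
    ∃ p : List V, IsInducedPath G p ∧ 2 ≤ p.length ∧ p.length + 1 = ks.sum ∧
      (∀ v ∈ p, v ∈ Y ∨ ∃ W ∈ L, v ∈ W) ∧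
      ∀ z ∈ X, z ∉ Y → ∀ v ∈ p,
        z ≠ v ∧ (G.Adj z v ↔ (z = x ∧ p.head? = some v) ∨ (z = y ∧ p.getLast? = some v)) := by
  classical
  induction L with
  | nil => simp
  | cons W L ih =>
    intro ks _ hks hk hL hpw x hx y hy hxy Y hYX hxY hyY hcard
    match ks, hks with
    | k :: ks, hks =>
    have hks' : ks.length = L.length := by simpa using hks
    by_cases hLn : L = []
    · subst hLn
      obtain rfl : ks = [] := by simpa using hks'
      obtain ⟨p, hp, hlen, hW⟩ := hL W (by simp) x hx y hy hxy k (hk k (by simp))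
      exact ⟨p, hp.path, hp.two_le_length, by simpa using hlen, fun v hv => .inr ⟨W, by simp, hW v hv⟩,
        fun z hz _ => hp.adj_iff z hz⟩
    have hpos := List.length_pos_iff.2 hLn
    rw [List.length_cons] at hcard
    obtain ⟨w, hw⟩ : Y.Nonempty := Finset.card_pos.1 (by lia)
    have hwX := hYX hw
    have hxw : x ≠ w := by rintro rfl; exact hxY hw
    have hyw : y ≠ w := by rintro rfl; exact hyY hw
    obtain ⟨p, hp, hplen, hpW⟩ := hL W (by simp) x hx w hwX hxw k (hk k (by simp))
    obtain ⟨q, hq, hq2, hqlen, hqL, hqX⟩ := ih ks hLn hks' (fun k h => hk k (by simp [h]))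
      (fun W h => hL W (by simp [h])) (List.pairwise_cons.1 hpw).2 w hwX y hy hyw.symm (Y.erase w)
      ((Finset.erase_subset _ _).trans hYX) (by simp) (by simp [hyY])
      (by rw [Finset.card_erase_of_mem hw]; lia)
    have hp2 := hp.two_le_length
    have hpn : p ≠ [] := List.ne_nil_of_length_pos (by lia)
    have hqn : q ≠ [] := List.ne_nil_of_length_pos (by lia)
    have hpq : ∀ u ∈ p, ∀ v ∈ q, u ≠ v ∧ ¬ G.Adj u v := by
      intro u hu v hv
      rcases hqL v hv with h | ⟨W', hW', h⟩
      · have hvY := Finset.mem_of_mem_erase h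
        have := hp.adj_iff v (hYX hvY) u hu
        refine ⟨this.1.symm, ?_⟩
        rw [G.adj_comm, this.2]
        rintro (⟨rfl, -⟩ | ⟨rfl, -⟩)
        · exact hxY hvY
        · simp at h
      · exact (List.pairwise_cons.1 hpw).1 W' hW' u (hpW u hu) v h
    have hwp : ∀ v ∈ p, w ≠ v ∧ (G.Adj w v ↔ p.getLast? = some v) := by
      intro v hv
      simpa [hxw.symm] using hp.adj_iff w hwX v hv
    have hwq : ∀ v ∈ q, w ≠ v ∧ (G.Adj w v ↔ q.head? = some v) := by
      intro v hv
      simpa [hyw.symm] using hqX w hwX (by simp) v hv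
    refine ⟨p ++ w :: q, hp.path.append_cons hq hpq hwp hwq, ?_, ?_, ?_, ?_⟩
    · simp only [List.length_append, List.length_cons]
      lia
    · simp only [List.length_append, List.length_cons, List.sum_cons]
      lia
    · intro v hv
      rcases List.mem_append.1 hv with hv | hv
      · exact .inr ⟨W, by simp, hpW v hv⟩
      rcases List.mem_cons.1 hv with rfl | hv
      · exact .inl hw
      · rcases hqL v hv with h | ⟨W', hW', h⟩
        · exact .inl (Finset.mem_of_mem_erase h)
        · exact .inr ⟨W', by simp [hW'], h⟩
    · intro z hz hzY v hv
      have hzw : z ≠ w := by rintro rfl; exact hzY hw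
      have hhead : (p ++ w :: q).head? = p.head? := by
        cases p with
        | nil => simp at hpn
        | cons a p => simp
      have hlast : (p ++ w :: q).getLast? = q.getLast? := by
        cases q with
        | nil => simp at hqn
        | cons a q => simp [List.getLast?_cons]
      rw [hhead, hlast]
      rcases List.mem_append.1 hv with hv | hv
      · have := hp.adj_iff z hz v hv
        have hne : q.getLast? ≠ some v := fun h => (hpq v hv v (List.mem_of_getLast? h)).1 rfl
        simpa [hzw, hne] using this
      rcases List.mem_cons.1 hv with rfl | hv
      · refine ⟨hzw, iff_of_false (hX z hz v hwX) ?_⟩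
        rintro (⟨-, h⟩ | ⟨-, h⟩)
        · exact (hwp v (List.mem_of_head? h)).1 rfl
        · exact (hwq v (List.mem_of_getLast? h)).1 rfl
      · have := hqX z hz (by simp [hzY]) v hv
        have hne : p.head? ≠ some v := fun h => (hpq v (List.mem_of_head? h) v hv).1 rfl
        simpa [hzw, hne] using this

lemma nonempty_cycleGraph_embedding_of_connectors {e : ℕ} {X : Finset V} (hX : StableSet G ↑X)
    {L : List (Set V)} {ks : List ℕ} (h2 : 2 ≤ L.length) (hks : ks.length = L.length)
    (hk : ∀ k ∈ ks, k = 4 ∨ k = e) (hL : ∀ W ∈ L, IsConnector G e X W)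
    (hpw : L.Pairwise (Anticomplete G)) (hcard : L.length ≤ X.card) :
    Nonempty (cycleGraph ks.sum ↪g G) := by
  classical
  obtain ⟨x, hx, y, hy, hxy⟩ := Finset.one_lt_card.1 (show 1 < X.card by lia)
  match L, ks, hks with
  | W :: L, k :: ks, hks =>
  simp only [List.length_cons] at h2 hcard hks
  obtain ⟨p, hp, hplen, hpW⟩ := hL W (by simp) x hx y hy hxy k (hk k (by simp))
  obtain ⟨q, hq, hq2, hqlen, hqL, hqX⟩ := exists_chain hX L ks
    (List.ne_nil_of_length_pos (by lia)) (by lia) (fun k h => hk k (by simp [h]))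
    (fun W h => hL W (by simp [h])) (List.pairwise_cons.1 hpw).2 y hy x hx hxy.symm
    ((X.erase x).erase y) ((Finset.erase_subset _ _).trans (Finset.erase_subset _ _))
    (by simp) (by simp) (by
      rw [Finset.card_erase_of_mem (by simp [hy, hxy.symm]), Finset.card_erase_of_mem hx]
      lia)
  have hp2 := hp.two_le_length
  have hpq : ∀ u ∈ p, ∀ v ∈ q, u ≠ v ∧ ¬ G.Adj u v := by
    intro u hu v hv
    rcases hqL v hv with h | ⟨W', hW', h⟩
    · simp only [Finset.mem_erase] at h
      have := hp.adj_iff v h.2.2 u hu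
      refine ⟨this.1.symm, ?_⟩
      rw [G.adj_comm, this.2]
      simp [h.1, h.2.1]
    · exact (List.pairwise_cons.1 hpw).1 W' hW' u (hpW u hu) v h
  have hyp : ∀ v ∈ p, y ≠ v ∧ (G.Adj y v ↔ p.getLast? = some v) := by
    intro v hv
    simpa [hxy.symm] using hp.adj_iff y hy v hv
  have hyq : ∀ v ∈ q, y ≠ v ∧ (G.Adj y v ↔ q.head? = some v) := by
    intro v hv
    simpa [hxy.symm] using hqX y hy (by simp) v hv
  refine (hp.path.append_cons hq hpq hyp hyq).nonempty_cycleGraph_embedding (a := x) ?_ ?_ ?_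
  · simp only [List.length_append, List.length_cons, List.sum_cons]
    lia
  · simp only [List.length_append, List.length_cons]
    lia
  · intro v hv
    have hhead : (p ++ y :: q).head? = p.head? := by
      cases p with
      | nil => simp at hp2
      | cons a p => simp
    have hlast : (p ++ y :: q).getLast? = q.getLast? := by
      cases q with
      | nil => simp at hq2
      | cons a q => simp [List.getLast?_cons]
    rw [hhead, hlast]
    rcases List.mem_append.1 hv with hv | hv
    · have hne : q.getLast? ≠ some v := fun h => (hpq v hv v (List.mem_of_getLast? h)).1 rfl
      simpa [hxy, hne] using hp.adj_iff x hx v hv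
    rcases List.mem_cons.1 hv with rfl | hv
    · refine ⟨hxy, iff_of_false (hX x hx v hy) ?_⟩
      rintro (h | h)
      · exact (hyp v (List.mem_of_head? h)).1 rfl
      · exact (hyq v (List.mem_of_getLast? h)).1 rfl
    · have hne : p.head? ≠ some v := fun h => (hpq v (List.mem_of_head? h) v hv).1 rfl
      simpa [hxy, hne] using hqX x hx (by simp) v hv

end InducedPaths

section Ladders

variable {G : SimpleGraph V}

/-- Every `x ∈ X` has two private neighbours `n x` and `n' x`, the first adjacent to `c` and not to
`c'` and the second adjacent to `c'` and not to `c`, where `c` and `c'` are adjacent. -/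
structure IsLadder (G : SimpleGraph V) (X : Finset V) (c c' : V) (n n' : V → V) : Prop where
  adj : G.Adj c c'
  adj_left : ∀ z ∈ X, ∀ x ∈ X, (G.Adj z (n x) ↔ z = x)
  adj_right : ∀ z ∈ X, ∀ x ∈ X, (G.Adj z (n' x) ↔ z = x)
  left_adj : ∀ x ∈ X, G.Adj (n x) c ∧ ¬ G.Adj (n x) c'
  right_adj : ∀ x ∈ X, G.Adj (n' x) c' ∧ ¬ G.Adj (n' x) c
  not_adj : ∀ x ∈ X, ¬ G.Adj x c ∧ ¬ G.Adj x c'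

namespace IsLadder

variable {X Y : Finset V} {c c' x y : V} {n n' : V → V}

lemma symm (h : IsLadder G X c c' n n') : IsLadder G X c' c n' n :=
  ⟨h.adj.symm, h.adj_right, h.adj_left, h.right_adj, h.left_adj, fun x hx => (h.not_adj x hx).symm⟩

lemma mono (h : IsLadder G X c c' n n') (hY : Y ⊆ X) : IsLadder G Y c c' n n' :=
  ⟨h.adj, fun z hz x hx => h.adj_left z (hY hz) x (hY hx),
    fun z hz x hx => h.adj_right z (hY hz) x (hY hx), fun x hx => h.left_adj x (hY hx),
    fun x hx => h.right_adj x (hY hx), fun x hx => h.not_adj x (hY hx)⟩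

lemma ne_left (h : IsLadder G X c c' n n') {z : V} (hz : z ∈ X) (hx : x ∈ X) : z ≠ n x := by
  intro hzx
  have h1 := (h.left_adj x hx).1
  rw [← hzx] at h1
  exact (h.not_adj z hz).1 h1

lemma ne_center (h : IsLadder G X c c' n n') (hx : x ∈ X) : x ≠ c := by
  rintro rfl
  exact (h.not_adj x hx).2 h.adj

lemma left_ne_center (h : IsLadder G X c c' n n') (hx : x ∈ X) : n x ≠ c' := by
  intro hn
  have h1 := (h.adj_left x hx x hx).2 rfl
  rw [hn] at h1
  exact (h.not_adj x hx).2 h1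

lemma left_ne_right (h : IsLadder G X c c' n n') (hx : x ∈ X) (hy : y ∈ X) : n x ≠ n' y := by
  intro hn
  have h1 := (h.left_adj x hx).1
  rw [hn] at h1
  exact (h.right_adj y hy).2 h1

lemma left_injOn (h : IsLadder G X c c' n n') (hx : x ∈ X) (hy : y ∈ X) (hn : n x = n y) :
    x = y := by
  rw [← h.adj_left x hx y hy, ← hn, h.adj_left x hx x hx]

lemma isLink_three (h : IsLadder G X c c' n n') (hx : x ∈ X) (hy : y ∈ X)
    (hxy : G.Adj (n x) (n' y)) : IsLink G X x y [n x, n' y] := by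
  have hne := h.left_ne_right hx hy
  refine ⟨by simp [IsInducedPath, hne, hxy], by simp, fun z hz v hv => ?_⟩
  have h1 := h.ne_left hz hx
  have h2 := h.symm.ne_left hz hy
  have h3 := h.adj_left z hz x hx
  have h4 := h.adj_right z hz y hy
  simp only [List.mem_cons, List.not_mem_nil, or_false] at hv
  rcases hv with rfl | rfl
  · simp [h1, h3, hne.symm]
  · simp [h2, h4, hne]

lemma isLink_four (h : IsLadder G X c c' n n') (hx : x ∈ X) (hy : y ∈ X) (hne : x ≠ y)
    (hxy : ¬ G.Adj (n x) (n y)) : IsLink G X x y [n x, c, n y] := by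
  have hn : n x ≠ n y := fun hn => hne (h.left_injOn hx hy hn)
  have h5 := (h.left_adj x hx).1
  have h6 := (h.left_adj y hy).1
  refine ⟨by simp [IsInducedPath, hn, hxy, h5, h6.symm, h5.ne, h6.ne'], by simp,
    fun z hz v hv => ?_⟩
  have h1 := h.ne_left hz hx
  have h2 := h.ne_left hz hy
  have h3 := h.adj_left z hz x hx
  have h4 := h.adj_left z hz y hy
  simp only [List.mem_cons, List.not_mem_nil, or_false] at hv
  rcases hv with rfl | rfl | rfl
  · simp [h1, h3, hn.symm]
  · simp [h.ne_center hz, (h.not_adj z hz).1, h5.ne, h6.ne]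
  · simp [h2, h4, hn]

lemma isLink_five (h : IsLadder G X c c' n n') (hx : x ∈ X) (hy : y ∈ X)
    (hxy : ¬ G.Adj (n x) (n' y)) : IsLink G X x y [n x, c, c', n' y] := by
  have hn := h.left_ne_right hx hy
  have h5 := h.left_adj x hx
  have h6 := h.right_adj y hy
  have h7 := h.left_ne_center hx
  have h8 := h.symm.left_ne_center hy
  have h9 := h6.2
  rw [G.adj_comm] at h9
  refine ⟨by simp [IsInducedPath, hn, hxy, h5, h6.1.symm, h9, h5.1.ne, h6.1.ne', h7, h8.symm,
    h.adj, h.adj.ne], by simp, fun z hz v hv => ?_⟩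
  have h1 := h.ne_left hz hx
  have h2 := h.symm.ne_left hz hy
  have h3 := h.adj_left z hz x hx
  have h4 := h.adj_right z hz y hy
  simp only [List.mem_cons, List.not_mem_nil, or_false] at hv
  rcases hv with rfl | rfl | rfl | rfl
  · simp [h1, h3, hn.symm]
  · simp [h.ne_center hz, (h.not_adj z hz).1, h5.1.ne, h8]
  · simp [h.symm.ne_center hz, (h.not_adj z hz).2, h7, h6.1.ne]
  · simp [h2, h4, hn]

lemma isConnector (h : IsLadder G X c c' n n') {W : Set V} (hc : c ∈ W) (hc' : c' ∈ W)
    (hnW : ∀ x ∈ X, n x ∈ W ∧ n' x ∈ W)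
    (hn : ∀ x ∈ X, ∀ y ∈ X, x ≠ y → ¬ G.Adj (n x) (n y)) {b : Prop}
    (hb : ∀ x ∈ X, ∀ y ∈ X, x ≠ y → (G.Adj (n x) (n' y) ↔ b) ∨ (G.Adj (n y) (n' x) ↔ b)) :
    ∃ e, (e = 3 ∨ e = 5) ∧ IsConnector G e X W := by
  by_cases hb' : b
  · refine ⟨3, by simp, fun x hx y hy hxy k hk => ?_⟩
    rcases hk with rfl | rfl
    · exact ⟨_, h.isLink_four hx hy hxy (hn x hx y hy hxy), rfl, by simp [hnW, hc, hx, hy]⟩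
    rcases hb x hx y hy hxy with hadj | hadj
    · exact ⟨_, h.isLink_three hx hy (hadj.2 hb'), rfl, by simp [hnW, hx, hy]⟩
    · exact ⟨_, h.symm.isLink_three hx hy (hadj.2 hb').symm, rfl, by simp [hnW, hx, hy]⟩
  · refine ⟨5, by simp, fun x hx y hy hxy k hk => ?_⟩
    rcases hk with rfl | rfl
    · exact ⟨_, h.isLink_four hx hy hxy (hn x hx y hy hxy), rfl, by simp [hnW, hc, hx, hy]⟩
    rcases hb x hx y hy hxy with hadj | hadj
    · exact ⟨_, h.isLink_five hx hy (fun h => hb' (hadj.1 h)), rfl,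
        by simp [hnW, hc, hc', hx, hy]⟩
    · exact ⟨_, h.symm.isLink_five hx hy (fun h => hb' (hadj.1 h.symm)), rfl,
        by simp [hnW, hc, hc', hx, hy]⟩

end IsLadder

/-- If no vertex of `N` is complete to the clique `K` covered by `N`, then two vertices of `N` have
incomparable neighbourhoods in `K`. -/
lemma exists_incomparable [Finite V] {N : Set V} {K : Finset V} (hK : K.Nonempty)
    (hNK : ∀ v ∈ K, ∃ u ∈ N, G.Adj u v) (hN : ∀ u ∈ N, ∃ v ∈ K, ¬ G.Adj u v) :
    ∃ c ∈ K, ∃ c' ∈ K, ∃ u ∈ N, ∃ u' ∈ N,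
      (G.Adj u c ∧ ¬ G.Adj u c') ∧ (G.Adj u' c' ∧ ¬ G.Adj u' c) := by
  classical
  obtain ⟨v, hv⟩ := hK
  obtain ⟨u₀, hu₀, -⟩ := hNK v hv
  obtain ⟨u, hu, hmax⟩ := N.toFinite.exists_maximalFor (fun u => (K.filter (G.Adj u)).card) N ⟨u₀, hu₀⟩
  obtain ⟨c', hc', huc'⟩ := hN u hu
  obtain ⟨u', hu', huc⟩ := hNK c' hc'
  obtain ⟨c, hc, hcu⟩ : ∃ c ∈ K.filter (G.Adj u), c ∉ K.filter (G.Adj u') := by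
    by_contra! hsub
    have hss : K.filter (G.Adj u) ⊂ K.filter (G.Adj u') :=
      (Finset.ssubset_iff_of_subset hsub).2 ⟨c', by simp [hc', huc], by simp [huc']⟩
    have := Finset.card_lt_card hss
    have := hmax hu' this.le
    simp only at this
    lia
  rw [Finset.mem_filter] at hc hcu
  exact ⟨c, hc.1, c', hc', u, hu, u', hu', ⟨hc.2, huc'⟩, huc, fun h => hcu ⟨hc.1, h⟩⟩

end Ladders

section Multicovers

variable {G : SimpleGraph V} {X X' : Finset V} {N M : V → Set V} {C C' : Set V}

lemma IsStableMulticover.mono (h : IsStableMulticover G X N C) (hX : X' ⊆ X) (hC : C' ⊆ C)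
    (hM : ∀ x ∈ X', M x ⊆ N x) (hMC : ∀ x ∈ X', ∀ v ∈ C', ∃ u ∈ M x, G.Adj u v) :
    IsStableMulticover G X' M C' := by
  obtain ⟨⟨hst, hcov, hpriv⟩, hstN⟩ := h
  refine ⟨⟨fun u hu v hv => hst u (hX hu) v (hX hv), fun x hx => ?_, fun x hx y hy hxy => ?_⟩,
    fun x hx u hu v hv => hstN x (hX hx) u (hM x hx hu) v (hM x hx hv)⟩
  · obtain ⟨h1, h2, h3, h4, -⟩ := hcov x (hX hx)
    exact ⟨fun u hu => h1 u (hM x hx hu), fun h => h2 (hC h), fun u hu => h3 u (hC hu),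
      h4.mono (hM x hx) hC, hMC x hx⟩
  · obtain ⟨h1, h2⟩ := hpriv x (hX hx) y (hX hy) hxy
    exact ⟨fun h => h1 (hM x hx h), fun u hu => h2 u (hM x hx hu)⟩

/-- Some connector lies in the multicover and is anticomplete to a smaller multicover, of length at
least `m` and of a set that is not `c`-colourable. -/
def HasConnector (G : SimpleGraph V) (X : Finset V) (N : V → Set V) (C : Set V) (m c : ℕ) : Prop :=
  ∃ X' ⊆ X, m ≤ X'.card ∧ ∃ (M : V → Set V) (C' : Set V), C' ⊆ C ∧ (∀ x ∈ X', M x ⊆ N x) ∧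
    IsStableMulticover G X' M C' ∧ ¬ (G.induce C').Colorable c ∧
    ∃ (W : Set V) (e : ℕ), (e = 3 ∨ e = 5) ∧ IsConnector G e X' W ∧
      W ⊆ (⋃ x ∈ X, N x) ∪ C ∧ Anticomplete G W ((⋃ x ∈ X', M x) ∪ C')

lemma biUnion_subset_biUnion (hX : X' ⊆ X) (hM : ∀ x ∈ X', M x ⊆ N x) :
    ⋃ x ∈ X', M x ⊆ ⋃ x ∈ X, N x := by
  intro v hv
  simp only [Set.mem_iUnion, exists_prop] at hv ⊢
  obtain ⟨x, hx, hv⟩ := hv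
  exact ⟨x, hX hx, hM x hx hv⟩

lemma HasConnector.mono {m c : ℕ} (h : HasConnector G X' M C' m c) (hX : X' ⊆ X)
    (hM : ∀ x ∈ X', M x ⊆ N x) (hC : C' ⊆ C) : HasConnector G X N C m c := by
  obtain ⟨Y, hY, hcard, L, D, hD, hL, hmc, hcol, W, e, he, hconn, hW, hanti⟩ := h
  exact ⟨Y, hY.trans hX, hcard, L, D, hD.trans hC, fun x hx => (hL x hx).trans (hM x (hY hx)), hmc,
    hcol, W, e, he, hconn,
    hW.trans (Set.union_subset_union (biUnion_subset_biUnion hX hM) hC), hanti⟩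

lemma IsConnector.mono {e : ℕ} {W : Set V} (h : IsConnector G e X W) (hX : X' ⊆ X) :
    IsConnector G e X' W := by
  intro x hx y hy hxy k hk
  obtain ⟨p, hp, hlen, hW⟩ := h x (hX hx) y (hX hy) hxy k hk
  exact ⟨p, ⟨hp.path, hp.two_le_length, fun z hz => hp.adj_iff z (hX hz)⟩, hlen, hW⟩

/-- The data extracted from a multicover before Ramsey's theorem is applied. -/
structure IsLadderCover (G : SimpleGraph V) (X : Finset V) (N M : V → Set V) (C E : Set V)
    (c c' : V) (n n' : V → V) : Prop where
  multicover : IsStableMulticover G X N C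
  subset : ∀ x ∈ X, M x ⊆ N x
  subset_right : E ⊆ C
  covers : ∀ x ∈ X, ∀ v ∈ E, ∃ u ∈ M x, G.Adj u v
  ladder : IsLadder G X c c' n n'
  left_mem : ∀ x ∈ X, n x ∈ N x
  right_mem : ∀ x ∈ X, n' x ∈ N x
  center_mem : c ∈ C ∧ c' ∈ C
  not_adj : ∀ x ∈ X, ∀ u ∈ M x, ¬ G.Adj u c ∧ ¬ G.Adj u c'

lemma IsLadderCover.mono {E E' : Set V} {L : V → Set V} {c c' : V} {n n' : V → V}
    (h : IsLadderCover G X N M C E c c' n n') (hX : X' ⊆ X) (hL : ∀ x ∈ X', L x ⊆ M x)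
    (hE : E' ⊆ E) (hLE : ∀ x ∈ X', ∀ v ∈ E', ∃ u ∈ L x, G.Adj u v) :
    IsLadderCover G X' N L C E' c c' n n' where
  multicover := h.multicover.mono hX subset_rfl (fun _ _ => subset_rfl)
    fun x hx => (h.multicover.1.2.1 x (hX hx)).2.2.2.2
  subset x hx := (hL x hx).trans (h.subset x (hX hx))
  subset_right := hE.trans h.subset_right
  covers := hLE
  ladder := h.ladder.mono hX
  left_mem x hx := h.left_mem x (hX hx)
  right_mem x hx := h.right_mem x (hX hx)
  center_mem := h.center_mem
  not_adj x hx u hu := h.not_adj x (hX hx) u (hL x hx hu)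

/-- A homogeneous ladder yields a connector. -/
lemma IsLadderCover.hasConnector {E : Set V} {c c' : V} {n n' : V → V} {d : ℕ} {b : Prop}
    (h : IsLadderCover G X N M C E c c' n n') (hE : ¬ (G.induce E).Colorable d)
    (hn : ∀ x ∈ X, ∀ y ∈ X, x ≠ y → ¬ G.Adj (n x) (n y))
    (hb : ∀ x ∈ X, ∀ y ∈ X, x ≠ y → (G.Adj (n x) (n' y) ↔ b) ∨ (G.Adj (n y) (n' x) ↔ b))
    (hM : ∀ x ∈ X, ∀ y ∈ X, x ≠ y → ∀ u ∈ M y, ¬ G.Adj (n x) u ∧ ¬ G.Adj (n' x) u)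
    (hEc : ∀ v ∈ E, ¬ G.Adj c v ∧ ¬ G.Adj c' v)
    (hEn : ∀ v ∈ E, ∀ x ∈ X, ¬ G.Adj (n x) v ∧ ¬ G.Adj (n' x) v) :
    HasConnector G X N C X.card d := by
  obtain ⟨e, he, hconn⟩ := h.ladder.isConnector (W := {c, c'} ∪ (n '' X ∪ n' '' X)) (by simp)
    (by simp) (fun x hx => ⟨.inr (.inl ⟨x, hx, rfl⟩), .inr (.inr ⟨x, hx, rfl⟩)⟩) hn hb
  refine ⟨X, subset_rfl, le_rfl, M, E, h.subset_right, h.subset,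
    h.multicover.mono subset_rfl h.subset_right h.subset h.covers, hE, _, e, he, hconn, ?_, ?_⟩
  · rintro v (hv | ⟨x, hx, rfl⟩ | ⟨x, hx, rfl⟩)
    · right
      rcases hv with rfl | rfl
      exacts [h.center_mem.1, h.center_mem.2]
    · exact .inl (Set.mem_biUnion hx (h.left_mem x hx))
    · exact .inl (Set.mem_biUnion hx (h.right_mem x hx))
  · have hcases (u v : V) (hu : u ∈ ({c, c'} ∪ (n '' X ∪ n' '' X) : Set V))
        (hv : v ∈ (⋃ x ∈ X, M x) ∪ E) : ¬ G.Adj u v := by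
      simp only [Set.mem_union, Set.mem_iUnion, exists_prop] at hv
      rcases hv with ⟨y, hy, hv⟩ | hv
      · have hvN := h.subset y hy hv
        rcases hu with hu | ⟨x, hx, rfl⟩ | ⟨x, hx, rfl⟩
        · rw [G.adj_comm]
          rcases hu with rfl | rfl
          exacts [(h.not_adj y hy v hv).1, (h.not_adj y hy v hv).2]
        · by_cases hxy : x = y
          · subst hxy
            exact h.multicover.2 x hx _ (h.left_mem x hx) v hvN
          · exact (hM x hx y hy hxy v hv).1
        · by_cases hxy : x = y
          · subst hxy
            exact h.multicover.2 x hx _ (h.right_mem x hx) v hvN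
          · exact (hM x hx y hy hxy v hv).2
      · rcases hu with hu | ⟨x, hx, rfl⟩ | ⟨x, hx, rfl⟩
        · rcases hu with rfl | rfl
          exacts [(hEc v hv).1, (hEc v hv).2]
        exacts [(hEn v hv x hx).1, (hEn v hv x hx).2]
    intro u hu v hv
    refine ⟨?_, hcases u v hu hv⟩
    rintro rfl
    rcases hu with hu | ⟨x, hx, rfl⟩ | ⟨x, hx, rfl⟩
    · rcases hu with rfl | rfl
      · exact hcases c' u (by simp) hv h.ladder.adj.symm
      · exact hcases c u (by simp) hv h.ladder.adj
    · exact hcases c (n x) (by simp) hv (h.ladder.left_adj x hx).1.symm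
    · exact hcases c' (n' x) (by simp) hv (h.ladder.right_adj x hx).1.symm

end Multicovers
section Gadgets

lemma cliqueFreeOn_of_forall_adj {G : SimpleGraph V} {S T : Set V} {v : V} {k : ℕ}
    (hS : G.CliqueFreeOn S (k + 1)) (hTS : T ⊆ S) (hv : v ∈ S) (hvT : ∀ u ∈ T, G.Adj v u) :
    G.CliqueFreeOn T k := by
  classical
  intro s hs hc
  refine hS (t := insert v s) ?_ (hc.insert fun u hu => hvT u (hs hu))
  rw [Finset.coe_insert]
  exact Set.insert_subset hv (hs.trans hTS)

/-- Large multicovers of sets of large chromatic number contain connectors, provided that the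
cliques in the covering sets have size at most `k`. -/
def ForcesConnector (τ κ k m c : ℕ) (m' c' : ℕ) : Prop :=
  ∀ (V : Type) [Finite V] (G : SimpleGraph V) (X : Finset V) (N : V → Set V) (C : Set V),
    CliqueControlled G τ κ → IsStableMulticover G X N C → m ≤ X.card →
    ¬ (G.induce C).Colorable c → G.CliqueFreeOn (⋃ x ∈ X, N x) (k + 1) → HasConnector G X N C m' c'

lemma IsLadderCover.hasConnector_of_forces {τ κ k m₁ c₁ : ℕ} {m d : ℕ}
    (h : ForcesConnector τ κ k m₁ c₁ m d) : ∃ R d₀ : ℕ,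
    ∀ (V : Type) [Finite V] (G : SimpleGraph V) (X : Finset V) (N M : V → Set V) (C E : Set V)
      (c c' : V) (n n' : V → V), CliqueControlled G τ κ → X.card = R →
      ¬ (G.induce E).Colorable d₀ → G.CliqueFreeOn (⋃ x ∈ X, N x) (k + 2) →
      IsLadderCover G X N M C E c c' n n' → HasConnector G X N C m d := by
  classical
  obtain ⟨R, hR⟩ := exists_sublist_pairwise (α := Prop × Prop × Prop × Prop × Prop × Prop)
    fun _ => m + m₁ + κ + 1
  refine ⟨R, 2 ^ ((R + R) * R) * max c₁ d + (R + R + 2) * τ,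
    fun V _ G X N M C E c c' n n' hG hX hE hfree hlad => ?_⟩
  set T : Finset (V × V) := (X.image n ∪ X.image n') ×ˢ X with hT
  have hF : (X.image n ∪ X.image n').card ≤ R + R := by
    refine (Finset.card_union_le _ _).trans (Nat.add_le_add ?_ ?_)
    · exact Finset.card_image_le.trans hX.le
    · exact Finset.card_image_le.trans hX.le
  have hTcard : T.card ≤ (R + R) * R := by
    rw [hT, Finset.card_product, hX]
    exact Nat.mul_le_mul_right _ hF
  set F : Finset V := (X.image n ∪ X.image n') ∪ {c, c'} with hFdef
  have hFcard : F.card ≤ R + R + 2 :=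
    (Finset.card_union_le _ _).trans (Nat.add_le_add hF Finset.card_le_two)
  obtain ⟨E', hE', hcolE', M', hM', hM'E', hpure⟩ :=
    exists_purified (G := G) (d := max c₁ d) X T M (E \ ⋃ v ∈ F, G.neighborSet v)
      (fun x hx v hv => hlad.covers x hx v hv.1) (by
        refine fun hcol => not_colorable_induce_diff hE ?_
          (hcol.mono (Nat.mul_le_mul_right _ (Nat.pow_le_pow_right (by simp) hTcard)))
        refine ((colorable_induce_biUnion F _ fun v _ => hG.colorable_neighborSet v).mono
          (Nat.mul_le_mul_right _ hFcard)).induce_mono Set.inter_subset_right)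
  have hEF : ∀ u ∈ F, ∀ v ∈ E', ¬ G.Adj u v := fun u hu v hv huv =>
    (hE' hv).2 (Set.mem_biUnion hu huv)
  have hE'E : E' ⊆ E := hE'.trans Set.sdiff_subset
  have hlad' {Y : Finset V} (hY : Y ⊆ X) : IsLadderCover G Y N M' C E' c c' n n' :=
    hlad.mono hY (fun x _ => hM' x) hE'E fun x hx => hM'E' x (hY hx)
  have hdrop (v : V) (l : List V) (hl : l.Sublist X.toList) (hlen : m₁ ≤ l.length)
      (hv : v ∈ ⋃ x ∈ X, N x) (hvl : ∀ y ∈ l, ∀ u ∈ M' y, G.Adj v u) :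
      HasConnector G X N C m d := by
    have hnd := hl.nodup X.nodup_toList
    have hsub : l.toFinset ⊆ X := fun x hx => by simpa using hl.subset (List.mem_toFinset.1 hx)
    have hMN : ∀ x ∈ l.toFinset, M' x ⊆ N x := (hlad' hsub).subset
    refine HasConnector.mono (X' := l.toFinset) (M := M') (C' := E') (h V G _ _ _ hG ?_ ?_ ?_ ?_)
      hsub hMN (hE'E.trans hlad.subset_right)
    · exact hlad.multicover.mono hsub (hE'E.trans hlad.subset_right) hMN (hlad' hsub).covers
    · rwa [List.toFinset_card_of_nodup hnd]
    · exact fun hc => hcolE' (hc.mono (le_max_left _ _))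
    · refine cliqueFreeOn_of_forall_adj hfree (biUnion_subset_biUnion hsub hMN) hv ?_
      intro u hu
      simp only [Set.mem_iUnion, List.mem_toFinset, exists_prop] at hu
      obtain ⟨y, hy, hu⟩ := hu
      exact hvl y hy u hu
  obtain ⟨⟨a₁, a₂, a₃, a₄, b₁, b₂⟩, l, hl, hlen, hpw⟩ := hR V (fun x y =>
    (∀ u ∈ M' y, G.Adj (n x) u, ∀ u ∈ M' y, G.Adj (n' x) u, ∀ u ∈ M' x, G.Adj (n y) u,
      ∀ u ∈ M' x, G.Adj (n' y) u, G.Adj (n x) (n y), G.Adj (n x) (n' y))) X.toList (by simp [hX])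
  simp only [Prod.mk.injEq, eq_iff_iff] at hpw
  have hnd := hl.nodup X.nodup_toList
  have hlX : ∀ x ∈ l, x ∈ X := fun x hx => by simpa using hl.subset hx
  have hmem (x : V) (hx : x ∈ X) : n x ∈ ⋃ x ∈ X, N x ∧ n' x ∈ ⋃ x ∈ X, N x :=
    ⟨Set.mem_biUnion hx (hlad.left_mem x hx), Set.mem_biUnion hx (hlad.right_mem x hx)⟩
  have hleft (v : V → V) (hv : ∀ x ∈ X, v x ∈ ⋃ x ∈ X, N x)
      (hadj : l.Pairwise fun x y => ∀ u ∈ M' y, G.Adj (v x) u) : HasConnector G X N C m d := by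
    match l, hl, hlen, hadj, hlX with
    | x :: l, hl, hlen, hadj, hlX =>
      refine hdrop (v x) l ((List.sublist_cons_self _ _).trans hl) ?_ (hv x (hlX x (by simp)))
        (List.pairwise_cons.1 hadj).1
      simp only [List.length_cons] at hlen
      lia
  have hright (v : V → V) (hv : ∀ x ∈ X, v x ∈ ⋃ x ∈ X, N x)
      (hadj : l.Pairwise fun x y => ∀ u ∈ M' x, G.Adj (v y) u) : HasConnector G X N C m d := by
    rcases l.eq_nil_or_concat' with rfl | ⟨l, x, rfl⟩
    · simp at hlen
    · rw [List.pairwise_append] at hadj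
      refine hdrop (v x) l ((List.sublist_append_left _ _).trans hl) ?_ (hv x (hlX x (by simp)))
        fun y hy => hadj.2.2 y hy x (by simp)
      simp only [List.length_append, List.length_singleton] at hlen
      lia
  by_cases h₁ : a₁
  · exact hleft n (fun x hx => (hmem x hx).1) (hpw.imp fun h => h.1.2 h₁)
  by_cases h₂ : a₂
  · exact hleft n' (fun x hx => (hmem x hx).2) (hpw.imp fun h => h.2.1.2 h₂)
  by_cases h₃ : a₃
  · exact hright n (fun x hx => (hmem x hx).1) (hpw.imp fun h => h.2.2.1.2 h₃)
  by_cases h₄ : a₄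
  · exact hright n' (fun x hx => (hmem x hx).2) (hpw.imp fun h => h.2.2.2.1.2 h₄)
  set Y := l.toFinset
  have hYX : Y ⊆ X := fun x hx => hlX x (List.mem_toFinset.1 hx)
  have hYcard : Y.card = m + m₁ + κ + 1 := by rw [List.toFinset_card_of_nodup hnd, hlen]
  by_cases h₅ : b₁
  · exfalso
    have : Std.Symm fun x y => G.Adj (n x) (n y) := ⟨fun _ _ h => h.symm⟩
    have hadj := List.Pairwise.forall (R := fun x y => G.Adj (n x) (n y))
      (hpw.imp fun h => h.2.2.2.2.1.2 h₅)
    refine hG.cliqueFree.mono (show κ + 1 ≤ Y.card by lia) (Y.image n) ⟨?_, ?_⟩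
    · intro u hu v hv huv
      simp only [Finset.coe_image, Set.mem_image, Finset.mem_coe] at hu hv
      obtain ⟨x, hx, rfl⟩ := hu
      obtain ⟨y, hy, rfl⟩ := hv
      exact hadj (List.mem_toFinset.1 hx) (List.mem_toFinset.1 hy)
        fun hxy => huv (by rw [hxy])
    · exact Finset.card_image_of_injOn fun x hx y hy hxy =>
        hlad.ladder.left_injOn (hYX hx) (hYX hy) hxy
  have hnF (x : V) (hx : x ∈ Y) : n x ∈ F ∧ n' x ∈ F := by
    have := hYX hx
    constructor <;> simp only [hFdef, Finset.mem_union, Finset.mem_image] <;> grind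
  have hpureY (x y : V) (hx : x ∈ X) (hy : y ∈ X) :
      ((∀ u ∈ M' y, G.Adj (n x) u) ∨ (∀ u ∈ M' y, ¬ G.Adj (n x) u)) ∧
      ((∀ u ∈ M' y, G.Adj (n' x) u) ∨ (∀ u ∈ M' y, ¬ G.Adj (n' x) u)) := by
    constructor
    · refine hpure (n x, y) (Finset.mem_product.2 ⟨Finset.mem_union_left _ ?_, hy⟩)
      exact Finset.mem_image_of_mem n hx
    · refine hpure (n' x, y) (Finset.mem_product.2 ⟨Finset.mem_union_right _ ?_, hy⟩)
      exact Finset.mem_image_of_mem n' hx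
  let P : V → V → Prop := fun x y =>
      ((∀ u ∈ M' y, ¬ G.Adj (n x) u ∧ ¬ G.Adj (n' x) u) ∧
        (∀ u ∈ M' x, ¬ G.Adj (n y) u ∧ ¬ G.Adj (n' y) u)) ∧ ¬ G.Adj (n x) (n y) ∧
        ((G.Adj (n x) (n' y) ↔ b₂) ∨ (G.Adj (n y) (n' x) ↔ b₂))
  have hpw' : l.Pairwise P := by
    refine hpw.imp_of_mem fun {x y} hx hy h => ?_
    obtain ⟨g₁, g₂, g₃, g₄, g₅, g₆⟩ := h
    have p₁ := hpureY x y (hlX x hx) (hlX y hy)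
    have p₂ := hpureY y x (hlX y hy) (hlX x hx)
    have q₁ := p₁.1.resolve_left fun h => h₁ (g₁.1 h)
    have q₂ := p₁.2.resolve_left fun h => h₂ (g₂.1 h)
    have q₃ := p₂.1.resolve_left fun h => h₃ (g₃.1 h)
    have q₄ := p₂.2.resolve_left fun h => h₄ (g₄.1 h)
    exact ⟨⟨fun u hu => ⟨q₁ u hu, q₂ u hu⟩, fun u hu => ⟨q₃ u hu, q₄ u hu⟩⟩,
      fun h => h₅ (g₅.1 h), .inl g₆⟩
  have : Std.Symm P := ⟨fun x y h => ⟨h.1.symm, fun h' => h.2.1 h'.symm, h.2.2.symm⟩⟩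
  have hall := hpw'.forall
  have hmemY {x : V} (hx : x ∈ Y) : x ∈ l := List.mem_toFinset.1 hx
  have hfin := (hlad' hYX).hasConnector (d := d) (b := b₂)
    (fun hc => hcolE' (hc.mono (le_max_right _ _)))
    (fun x hx y hy hxy => (hall (hmemY hx) (hmemY hy) hxy).2.1)
    (fun x hx y hy hxy => (hall (hmemY hx) (hmemY hy) hxy).2.2)
    (fun x hx y hy hxy => (hall (hmemY hx) (hmemY hy) hxy).1.1)
    (fun v hv => ⟨hEF c (by simp [hFdef]) v hv, hEF c' (by simp [hFdef]) v hv⟩)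
    (fun v hv x hx => ⟨hEF _ (hnF x hx).1 v hv, hEF _ (hnF x hx).2 v hv⟩)
  obtain ⟨X', hX', hcard, hrest⟩ := hfin.mono hYX (fun _ _ => subset_rfl) subset_rfl
  exact ⟨X', hX', by lia, hrest⟩

lemma exists_forcesConnector (τ κ k m c : ℕ) : ∃ m₀ c₀, ForcesConnector τ κ k m₀ c₀ m c := by
  classical
  induction k with
  | zero =>
    refine ⟨1, 0, fun V _ G X N C hG hmc hX hC hfree => ?_⟩
    obtain ⟨x, hx⟩ := Finset.card_pos.1 hX
    obtain ⟨v, hv⟩ := nonempty_of_not_colorable hC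
    obtain ⟨u, hu, -⟩ := (hmc.1.2.1 x hx).2.2.2.2 v hv
    refine (hfree (t := {u}) ?_ (SimpleGraph.isNClique_singleton.2 rfl)).elim
    rw [Finset.coe_singleton, Set.singleton_subset_iff]
    exact Set.mem_biUnion hx hu
  | succ k ih =>
    obtain ⟨m₁, c₁, h₁⟩ := ih
    obtain ⟨R, d₀, hR⟩ := IsLadderCover.hasConnector_of_forces h₁
    obtain ⟨m₀, c₀, h⟩ := exists_split_uniform τ (κ * κ * R + 1) (max τ d₀)
    refine ⟨m₀, c₀, fun V _ G X N C hG hmc hX hC hfree => ?_⟩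
    obtain ⟨Y, hYX, hYcard, D, hD, E, hE, hcolD, hcolE, M, hM⟩ := h V G X N C
      hG.colorable_neighborSet hX (fun x hx => (hmc.1.2.1 x hx).2.2.2.2) hC
    obtain ⟨K, hKD, hK⟩ := hG.exists_isNClique fun hc => hcolD (hc.mono (le_max_left _ _))
    have hKpos : K.Nonempty := by
      rw [← Finset.card_pos, hK.card_eq, Nat.pos_iff_ne_zero]
      rintro rfl
      obtain ⟨v, -⟩ := nonempty_of_not_colorable hC
      exact hG.cliqueFree {v} (SimpleGraph.isNClique_singleton.2 rfl)
    have hpairs : ∀ x ∈ Y, ∃ c ∈ K, ∃ c' ∈ K, ∃ u ∈ N x, ∃ u' ∈ N x,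
        (G.Adj u c ∧ ¬ G.Adj u c') ∧ (G.Adj u' c' ∧ ¬ G.Adj u' c) := fun x hx => by
      refine exists_incomparable hKpos ?_ fun u hu => ?_
      · exact fun v hv => (hmc.1.2.1 x (hYX hx)).2.2.2.2 v (hD (hKD hv))
      · by_contra! hall
        exact hG.cliqueFree _ (hK.insert hall)
    choose! f hf f' hf' n hn n' hn' hadj using hpairs
    obtain ⟨⟨c, c'⟩, hcc, hcard⟩ := Finset.exists_lt_card_fiber_of_mul_lt_card_of_maps_to
      (s := Y) (t := K ×ˢ K) (f := fun x => (f x, f' x)) (n := R)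
      (fun x hx => Finset.mem_product.2 ⟨hf x hx, hf' x hx⟩)
      (by rw [Finset.card_product, hK.card_eq, hYcard]; lia)
    obtain ⟨Z, hZ, hZcard⟩ := Finset.exists_subset_card_eq hcard.le
    rw [Finset.mem_product] at hcc
    have hZY : Z ⊆ Y := hZ.trans (Finset.filter_subset _ _)
    have hZX : Z ⊆ X := hZY.trans hYX
    have hZf : ∀ x ∈ Z, f x = c ∧ f' x = c' := fun x hx => by
      simpa using (Finset.mem_filter.1 (hZ hx)).2
    have hadjZ : ∀ x ∈ Z, (G.Adj (n x) c ∧ ¬ G.Adj (n x) c') ∧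
        (G.Adj (n' x) c' ∧ ¬ G.Adj (n' x) c) := fun x hx => by
      have := hadj x (hZY hx)
      rwa [(hZf x hx).1, (hZf x hx).2] at this
    have hccne : c ≠ c' := by
      obtain ⟨x, hx⟩ := Finset.card_pos.1 (Nat.zero_lt_of_lt hcard)
      obtain ⟨hxY, hxc⟩ := Finset.mem_filter.1 hx
      obtain ⟨rfl, rfl⟩ := Prod.mk.inj hxc
      intro h
      have := (hadj x hxY).1
      rw [← h] at this
      exact this.2 this.1
    have hprivate (v : V → V) (hv : ∀ x ∈ Y, v x ∈ N x) (z : V) (hz : z ∈ Z) (x : V) (hx : x ∈ Z) :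
        G.Adj z (v x) ↔ z = x := by
      have hvx := hv x (hZY hx)
      constructor
      · intro h
        by_contra hne
        exact (hmc.1.2.2 x (hZX hx) z (hZX hz) (Ne.symm hne)).2 _ hvx h
      · rintro rfl
        exact (hmc.1.2.1 z (hZX hz)).1 _ hvx
    have hnC (x : V) (hx : x ∈ Z) := (hmc.1.2.1 x (hZX hx)).2.2.1
    have hcD := hKD hcc.1
    have hcD' := hKD hcc.2
    have hlad : IsLadder G Z c c' n n' := ⟨hK.isClique hcc.1 hcc.2 hccne, hprivate n hn,
      hprivate n' hn', fun x hx => (hadjZ x hx).1, fun x hx => (hadjZ x hx).2,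
      fun x hx => ⟨hnC x hx c (hD hcD), hnC x hx c' (hD hcD')⟩⟩
    refine (hR V G Z N M C E c c' n n' hG hZcard (fun hc => hcolE (hc.mono (le_max_right _ _)))
      ?_ ?_).mono hZX (fun _ _ => subset_rfl) subset_rfl
    · exact fun s hs => hfree (hs.trans (biUnion_subset_biUnion hZX fun _ _ => subset_rfl))
    · exact
      { multicover := hmc.mono hZX subset_rfl (fun _ _ => subset_rfl)
          fun x hx => (hmc.1.2.1 x (hZX hx)).2.2.2.2
        subset := fun x hx => (hM x (hZY hx)).1
        subset_right := hE
        covers := fun x hx => (hM x (hZY hx)).2.1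
        ladder := hlad
        left_mem := fun x hx => hn x (hZY hx)
        right_mem := fun x hx => hn' x (hZY hx)
        center_mem := ⟨hD hcD, hD hcD'⟩
        not_adj := fun x hx u hu =>
          ⟨(hM x (hZY hx)).2.2 u hu c hcD, (hM x (hZY hx)).2.2 u hu c' hcD'⟩ }

/-- A long multicover of a set of large chromatic number contains many pairwise anticomplete
connectors. -/
lemma exists_connectors (τ κ r m : ℕ) : ∃ m₀ c₀ : ℕ, ∀ (V : Type) [Finite V] (G : SimpleGraph V)
    (X : Finset V) (N : V → Set V) (C : Set V),
    CliqueControlled G τ κ → IsStableMulticover G X N C → m₀ ≤ X.card →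
    ¬ (G.induce C).Colorable c₀ →
    ∃ X' ⊆ X, m ≤ X'.card ∧ ∃ L₃ L₅ : List (Set V), L₃.length + L₅.length = r ∧
      (∀ W ∈ L₃, IsConnector G 3 X' W) ∧ (∀ W ∈ L₅, IsConnector G 5 X' W) ∧
      L₃.Pairwise (Anticomplete G) ∧ L₅.Pairwise (Anticomplete G) ∧
      ∀ W, W ∈ L₃ ∨ W ∈ L₅ → W ⊆ (⋃ x ∈ X, N x) ∪ C := by
  induction r with
  | zero =>
    refine ⟨m, 0, fun V _ G X N C _ _ hX _ => ⟨X, subset_rfl, hX, [], [], rfl, ?_⟩⟩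
    simp
  | succ r ih =>
    obtain ⟨m₁, c₁, h₁⟩ := ih
    obtain ⟨m₀, c₀, h₀⟩ := exists_forcesConnector τ κ κ m₁ c₁
    refine ⟨m₀, c₀, fun V _ G X N C hG hmc hX hC => ?_⟩
    obtain ⟨Y, hYX, hY, M, D, hDC, hMN, hmc', hD, W, e, he, hW, hWsub, hanti⟩ :=
      h₀ V G X N C hG hmc hX hC (hG.cliqueFree.cliqueFreeOn)
    obtain ⟨X', hX', hcard, L₃, L₅, hlen, h₃, h₅, hp₃, hp₅, hsub⟩ := h₁ V G Y M D hG hmc' hY hD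
    have hW' := hW.mono hX'
    have hsub' (U : Set V) (hU : U ∈ L₃ ∨ U ∈ L₅) : U ⊆ (⋃ x ∈ X, N x) ∪ C :=
      (hsub U hU).trans (Set.union_subset_union (biUnion_subset_biUnion hYX hMN) hDC)
    have hanti' (U : Set V) (hU : U ∈ L₃ ∨ U ∈ L₅) : Anticomplete G W U :=
      fun u hu v hv => hanti u hu v (hsub U hU hv)
    refine ⟨X', hX'.trans hYX, hcard, ?_⟩
    rcases he with rfl | rfl
    · refine ⟨W :: L₃, L₅, by simp only [List.length_cons]; lia, List.forall_mem_cons.2 ⟨hW', h₃⟩,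
        h₅, List.pairwise_cons.2 ⟨fun U hU => hanti' U (.inl hU), hp₃⟩, hp₅, ?_⟩
      rintro U (hU | hU)
      · rcases List.mem_cons.1 hU with rfl | hU
        exacts [hWsub, hsub' U (.inl hU)]
      · exact hsub' U (.inr hU)
    · refine ⟨L₃, W :: L₅, by simp only [List.length_cons]; lia, h₃,
        List.forall_mem_cons.2 ⟨hW', h₅⟩, hp₃,
        List.pairwise_cons.2 ⟨fun U hU => hanti' U (.inr hU), hp₅⟩, ?_⟩
      rintro U (hU | hU)
      · exact hsub' U (.inl hU)
      · rcases List.mem_cons.1 hU with rfl | hU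
        exacts [hWsub, hsub' U (.inr hU)]

lemma CliqueControlled.of_cliqueNum [Finite V] {G : SimpleGraph V} {τ κ : ℕ} (hG : G.cliqueNum ≤ κ)
    (h : ∀ Y : Set V, (G.induce Y).cliqueNum < κ → (G.induce Y).chromaticNumber ≤ (τ : ℕ∞)) :
    CliqueControlled G τ κ where
  cliqueFree s hs := by
    have := hs.isClique.card_le_cliqueNum
    have := hs.card_eq
    lia
  colorable Y hY := by
    rw [← SimpleGraph.chromaticNumber_le_iff_colorable]
    refine h Y ?_
    by_contra! hκ
    obtain ⟨s, hs⟩ := (G.induce Y).exists_isNClique_cliqueNum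
    obtain ⟨t, hts, ht⟩ := Finset.exists_subset_card_eq (hs.card_eq ▸ hκ)
    have htc : (G.induce Y).IsNClique κ t := ⟨hs.isClique.subset hts, ht⟩
    have hmap := htc.map (f := Function.Embedding.subtype (· ∈ Y))
    refine hY (t := t.map (Function.Embedding.subtype (· ∈ Y))) ?_
      (hmap.mono (SimpleGraph.map_comap_le _ _))
    intro v hv
    simp only [Finset.coe_map, Set.mem_image] at hv
    obtain ⟨u, -, rfl⟩ := hv
    exact u.2

/-- Connectors allow for induced cycles of each length `p * e + q * 4` with `p + q` connectors. -/
lemma nonempty_cycleGraph_embedding_of_add {G : SimpleGraph V} {e p q ℓ : ℕ} {X : Finset V}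
    (hX : StableSet G ↑X) {L : List (Set V)} (h2 : 2 ≤ p + q) (hℓ : p * e + q * 4 = ℓ)
    (hlen : p + q ≤ L.length) (hcard : p + q ≤ X.card) (hL : ∀ W ∈ L, IsConnector G e X W)
    (hpw : L.Pairwise (Anticomplete G)) : Nonempty (cycleGraph ℓ ↪g G) := by
  have htake : (L.take (p + q)).length = p + q := by simpa using hlen
  have := nonempty_cycleGraph_embedding_of_connectors (e := e) hX (L := L.take (p + q))
    (ks := List.replicate p e ++ List.replicate q 4) (by rwa [htake]) (by simp [htake])
    (fun k hk => by
      rcases List.mem_append.1 hk with hk | hk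
      · exact .inr (List.eq_of_mem_replicate hk)
      · exact .inl (List.eq_of_mem_replicate hk))
    (fun W hW => hL W (List.mem_of_mem_take hW)) (hpw.sublist (List.take_sublist _ _))
    (by rwa [htake])
  have hsum : (List.replicate p e ++ List.replicate q 4).sum = ℓ := by simp [hℓ]
  rwa [hsum] at this

end Gadgets
theorem stmt10 (ℓ : ℕ) (hℓ : 24 ≤ ℓ) (τ κ : ℕ) :
    ∃ m c : ℕ, ∀ (V : Type) [Fintype V] (G : SimpleGraph V)
      (X : Finset V) (N : V → Set V) (C : Set V) (a : Fin ℓ → V) (b : Fin ℓ → V → V),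
      G.cliqueNum ≤ κ →
      (∀ Y : Set V, (G.induce Y).cliqueNum < κ →
        (G.induce Y).chromaticNumber ≤ (τ : ℕ∞)) →
      IsStableMulticover G X N C → StablyCrested G X N C ℓ a b → X.card = m →
      (c : ℕ∞) < (G.induce C).chromaticNumber →
      (4 ≤ ℓ ∧ Nonempty (cycleGraph ℓ ↪g G)) := by
  obtain ⟨m, c, h⟩ := exists_connectors τ κ (2 * ℓ) ℓ
  refine ⟨m, c, fun V _ G X N C a b hω hχ hmc _ hX hC => ⟨by lia, ?_⟩⟩
  obtain ⟨Y, hYX, hY, L₃, L₅, hlen, h₃, h₅, hp₃, hp₅, -⟩ := h V G X N C (.of_cliqueNum hω hχ) hmc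
    hX.ge fun hcol => hC.not_ge (SimpleGraph.chromaticNumber_le_iff_colorable.2 hcol)
  have hst : StableSet G ↑Y := fun u hu v hv => hmc.1.1 u (hYX hu) v (hYX hv)
  rcases le_total ℓ L₃.length with hl | hl
  · exact nonempty_cycleGraph_embedding_of_add (p := 4 * ((ℓ + 3) / 4) - ℓ)
      (q := (ℓ + 3) / 4 - (4 * ((ℓ + 3) / 4) - ℓ)) hst (by lia) (by lia) (by lia) (by lia) h₃ hp₃
  · exact nonempty_cycleGraph_embedding_of_add (p := ℓ % 4) (q := ℓ / 4 - ℓ % 4) hst (by lia)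
      (by lia) (by lia) (by lia) h₅ hp₅
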